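/- Let $\mathcal{F}$ be an IFS of contractions over a complete metric space with similarity dimension $s$, whose attractor $K$ is connected, has positive diameter, and such that $\mathcal{F}$ has no branching. Then there exists a $(1/s)$-Hölder homeomorphism $f : [0,1] \to K$ (in particular, $K$ is a Hölder arc). -/

import Mathlib

open Set

/-- `φ_w = φ_{i₁} ∘ ⋯ ∘ φ_{iₙ}` for a word `w = i₁ ⋯ iₙ`. -/
noncomputable def compWord {X : Type*} {k : ℕ} (φ : Fin k → X → X)
    (w : List (Fin k)) : X → X :=
  w.foldr (fun i g => φ i ∘ g) id

structure GData {X : Type*} {k : ℕ} (A : List (Fin k) → Set X) : Prop where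
  ne : ∀ w, (A w).Nonempty
  un : ∀ w, A w = ⋃ j, A (w ++ [j])
  app : ∀ w u v, (A u ∩ A v).Nonempty → (A (w ++ u) ∩ A (w ++ v)).Nonempty

structure PosData {X : Type*} {k : ℕ} (A : List (Fin k) → Set X)
    (pos : List (Fin k) → ℕ) : Prop where
  inj : ∀ u v, u.length = v.length → pos u = pos v → u = v
  adj : ∀ u v, u.length = v.length → u ≠ v →
    ((A u ∩ A v).Nonempty ↔ (pos u + 1 = pos v ∨ pos v + 1 = pos u))
  compat : ∀ u v i j, u.length = v.length → pos u < pos v → pos (u ++ [i]) < pos (v ++ [j])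
  ivt : ∀ w i j m, pos (w ++ [i]) ≤ m → m ≤ pos (w ++ [j]) → ∃ l, pos (w ++ [l]) = m

def wG {X : Type*} {k : ℕ} (A : List (Fin k) → Set X) : SimpleGraph (List (Fin k)) where
  Adj u v := u.length = v.length ∧ u ≠ v ∧ (A u ∩ A v).Nonempty
  symm := ⟨fun u v h => ⟨h.1.symm, h.2.1.symm, by rw [inter_comm]; exact h.2.2⟩⟩
  loopless := ⟨fun u h => h.2.1 rfl⟩

def IsEnd {X : Type*} {k : ℕ} (A : List (Fin k) → Set X) (w : List (Fin k)) : Prop :=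
  ∀ a b, (wG A).Adj w a → (wG A).Adj w b → a = b

section graph
variable {X : Type*} {k : ℕ} {A : List (Fin k) → Set X}

lemma wG_len {u v : List (Fin k)} (h : (wG A).Reachable u v) : u.length = v.length := by
  obtain ⟨p⟩ := h
  induction p with
  | nil => rfl
  | cons h _ ih => exact h.1.trans ih

lemma exists_prev {e u : List (Fin k)} {m : ℕ} (h : (wG A).Reachable e u)
    (hd : (wG A).dist e u = m + 1) :
    ∃ v, (wG A).Adj u v ∧ (wG A).Reachable e v ∧ (wG A).dist e v = m := by
  obtain ⟨p, hp⟩ := h.symm.exists_walk_length_eq_dist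
  rw [SimpleGraph.dist_comm, hd] at hp
  cases p with
  | nil => simp at hp
  | @cons _ v _ ha q =>
    refine ⟨v, ha, q.reachable.symm, ?_⟩
    simp at hp
    have h1 := SimpleGraph.dist_le q.reverse
    rw [SimpleGraph.Walk.length_reverse, hp] at h1
    obtain ⟨r, hr⟩ := q.reachable.symm.exists_walk_length_eq_dist
    have h2 := SimpleGraph.dist_le (r.concat ha.symm)
    rw [SimpleGraph.Walk.length_concat] at h2
    omega

lemma dist_adj {e u v : List (Fin k)} (h : (wG A).Reachable e u) (ha : (wG A).Adj u v) :
    (wG A).dist e v ≤ (wG A).dist e u + 1 := by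
  obtain ⟨r, hr⟩ := h.exists_walk_length_eq_dist
  have h2 := SimpleGraph.dist_le (r.concat ha)
  rw [SimpleGraph.Walk.length_concat] at h2
  omega

lemma dist_inj (hdeg : ∀ w a b c, (wG A).Adj w a → (wG A).Adj w b → (wG A).Adj w c →
      a = b ∨ a = c ∨ b = c)
    {e : List (Fin k)} (he : IsEnd A e) (m : ℕ) :
    ∀ u v, (wG A).Reachable e u → (wG A).Reachable e v → (wG A).dist e u = m →
      (wG A).dist e v = m → u = v := by
  induction m with
  | zero =>
    intro u v hu hv h1 h2
    rw [hu.dist_eq_zero_iff] at h1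
    rw [hv.dist_eq_zero_iff] at h2
    rw [← h1, h2]
  | succ m ih =>
    intro u v hu hv h1 h2
    obtain ⟨u', a1, r1, d1⟩ := exists_prev hu h1
    obtain ⟨v', a2, r2, d2⟩ := exists_prev hv h2
    obtain rfl := ih u' v' r1 r2 d1 d2
    cases m with
    | zero =>
      rw [r1.dist_eq_zero_iff] at d1
      subst d1
      exact he _ _ a1.symm a2.symm
    | succ m =>
      obtain ⟨t, a3, r3, d3⟩ := exists_prev r1 d1
      rcases hdeg u' t u v a3 a1.symm a2.symm with h | h | h
      · subst h; omega
      · subst h; omega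
      · exact h

lemma walk_ivt {g : List (Fin k) → ℕ} (hg : ∀ u v, (wG A).Adj u v → g v ≤ g u + 1)
    {u v : List (Fin k)} (h : (wG A).Reachable u v) (m : ℕ) (h1 : g u ≤ m) (h2 : m ≤ g v) :
    ∃ x, (wG A).Reachable u x ∧ g x = m := by
  obtain ⟨p⟩ := h
  induction p with
  | nil => exact ⟨_, SimpleGraph.Reachable.refl _, by omega⟩
  | @cons u v' w ha p ih =>
    by_cases h : g v' ≤ m
    · obtain ⟨x, hx, e⟩ := ih h h2
      exact ⟨x, ha.reachable.trans hx, e⟩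
    · have := hg _ _ ha
      exact ⟨u, SimpleGraph.Reachable.refl _, by omega⟩

lemma adj_app (hA : GData A) (w : List (Fin k)) {u v : List (Fin k)} (h : (wG A).Adj u v) :
    (wG A).Adj (w ++ u) (w ++ v) :=
  ⟨by simp [h.1], by simpa using h.2.1, hA.app w u v h.2.2⟩

lemma fib_ivt (hA : GData A) (hc : ∀ u v : List (Fin k), u.length = v.length → (wG A).Reachable u v)
    {e : List (Fin k)} (w : List (Fin k)) (hl : e.length = w.length + 1) (i j : Fin k) (m : ℕ)
    (h1 : (wG A).dist e (w ++ [i]) ≤ m) (h2 : m ≤ (wG A).dist e (w ++ [j])) :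
    ∃ l, (wG A).dist e (w ++ [l]) = m := by
  have hr : (wG A).Reachable [i] [j] := hc _ _ rfl
  -- truncated function: outside level one we use a constant
  obtain ⟨x, hx, hxm⟩ := walk_ivt (A := A)
    (g := fun x => if x.length = 1 then (wG A).dist e (w ++ x) else 0) (by
      intro u v ha
      have := ha.1
      by_cases hu : u.length = 1
      · have hv : v.length = 1 := by omega
        simp only [hu, hv, if_true]
        exact dist_adj (hc _ _ (by simp [hl, hu])) (adj_app hA w ha)
      · have hv : v.length ≠ 1 := by omega
        simp [hu, hv]) hr m (by simpa using h1) (by simpa using h2)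
  have hl := wG_len hx
  simp only [List.length_singleton] at hl
  rw [if_pos hl.symm] at hxm
  obtain ⟨l, rfl⟩ := List.length_eq_one_iff.1 hl.symm
  exact ⟨l, hxm⟩

lemma adj_lift (hA : GData A) {u v : List (Fin k)} (h : (wG A).Adj u v) :
    ∃ i j, (wG A).Adj (u ++ [i]) (v ++ [j]) := by
  obtain ⟨h1, h2, x, hx, hy⟩ := h
  rw [hA.un] at hx hy
  obtain ⟨i, hi⟩ := mem_iUnion.1 hx
  obtain ⟨j, hj⟩ := mem_iUnion.1 hy
  exact ⟨i, j, by simp [h1], fun h => h2 (List.append_inj_left h h1), x, hi, hj⟩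

lemma adj_down (hA : GData A) {u v : List (Fin k)} {i j} (h : (wG A).Adj (u ++ [i]) (v ++ [j])) :
    u = v ∨ (wG A).Adj u v := by
  by_cases huv : u = v
  · exact Or.inl huv
  · obtain ⟨h1, h2, x, hx, hy⟩ := h
    refine Or.inr ⟨by simpa using h1, huv, x, ?_, ?_⟩
    · rw [hA.un]; exact mem_iUnion.2 ⟨i, hx⟩
    · rw [hA.un]; exact mem_iUnion.2 ⟨j, hy⟩

lemma end_exists (hA : GData A) [Nontrivial (Fin k)]
    (hc : ∀ u v : List (Fin k), u.length = v.length → (wG A).Reachable u v)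
    (hdeg : ∀ w a b c, (wG A).Adj w a → (wG A).Adj w b → (wG A).Adj w c →
      a = b ∨ a = c ∨ b = c) (n : ℕ) : ∃ w, w.length = n ∧ IsEnd A w := by
  by_contra hcon
  push Not at hcon
  obtain ⟨i, j, hij⟩ := exists_pair_ne (Fin k)
  have key : ∀ u v, (wG A).Reachable u v → (∃ u', u = i :: u' ∧ u'.length = n) →
      ∃ v', v = i :: v' ∧ v'.length = n := by
    rintro u v ⟨p⟩
    induction p with
    | nil => exact id
    | @cons u v' w ha p ih =>
      rintro ⟨u', rfl, hl⟩
      apply ih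
      have := hcon u' hl
      unfold IsEnd at this
      push Not at this
      obtain ⟨a, b, h1, h2, h3⟩ := this
      have h1' := adj_app hA [i] h1
      have h2' := adj_app hA [i] h2
      rcases hdeg _ _ _ _ h1' h2' ha with h | h | h
      · exact absurd (by simpa using h) h3
      · exact ⟨a, h.symm, by rw [← h1.1, hl]⟩
      · exact ⟨b, h.symm, by rw [← h2.1, hl]⟩
  obtain ⟨v', h, -⟩ := key (i :: List.replicate n i) (j :: List.replicate n i) (hc _ _ (by simp))
    ⟨_, rfl, by simp⟩
  simp at h
  exact hij h.1.symm

lemma end_parent (hA : GData A) 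
    (hc : ∀ u v : List (Fin k), u.length = v.length → (wG A).Reachable u v)
    (hdeg : ∀ w a b c, (wG A).Adj w a → (wG A).Adj w b → (wG A).Adj w c →
      a = b ∨ a = c ∨ b = c) (w : List (Fin k)) (j) (he : IsEnd A (w ++ [j])) : IsEnd A w := by
  have inj : ∀ u v : List (Fin k), u.length = w.length + 1 → v.length = w.length + 1 →
      (wG A).dist (w ++ [j]) u = (wG A).dist (w ++ [j]) v → u = v := fun u v hu hv h =>
    dist_inj hdeg he _ u v (hc _ _ (by simp [hu])) (hc _ _ (by simp [hv])) h rfl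
  have notin : ∀ a i i', a.length = w.length → a ≠ w →
      (wG A).dist (w ++ [j]) (w ++ [i]) < (wG A).dist (w ++ [j]) (a ++ [i']) := by
    intro a i i' hl hne
    by_contra hlt
    obtain ⟨l, h⟩ := fib_ivt (e := w ++ [j]) hA hc w (by simp) j i
      ((wG A).dist (w ++ [j]) (a ++ [i'])) (by simp) (by omega)
    have := inj _ _ (by simp) (by simp [hl]) h
    exact hne (List.append_inj_left this hl.symm).symm
  intro a b ha hb
  by_contra hab
  obtain ⟨i1, i2, h1⟩ := adj_lift hA ha
  obtain ⟨i3, i4, h2⟩ := adj_lift hA hb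
  have d1 := dist_adj (e := w ++ [j]) (hc _ _ (by simp)) h1
  have d2 := dist_adj (e := w ++ [j]) (hc _ _ (by simp)) h2
  have n1 := notin a i1 i2 ha.1.symm ha.2.1.symm
  have n2 := notin a i3 i2 ha.1.symm ha.2.1.symm
  have n3 := notin b i1 i4 hb.1.symm hb.2.1.symm
  have n4 := notin b i3 i4 hb.1.symm hb.2.1.symm
  have := inj (a ++ [i2]) (b ++ [i4]) (by simp [ha.1]) (by simp [hb.1]) (by omega)
  exact hab (List.append_inj_left this (ha.1.symm.trans hb.1))

lemma end_prefix (hA : GData A) 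
    (hc : ∀ u v : List (Fin k), u.length = v.length → (wG A).Reachable u v)
    (hdeg : ∀ w a b c, (wG A).Adj w a → (wG A).Adj w b → (wG A).Adj w c →
      a = b ∨ a = c ∨ b = c) (w u : List (Fin k)) (he : IsEnd A (w ++ u)) : IsEnd A w := by
  induction u using List.reverseRecOn with
  | nil => simpa using he
  | append_singleton u j ih =>
    apply ih
    rw [← List.append_assoc] at he
    exact end_parent hA hc hdeg _ j he

lemma end_chain (hA : GData A) [Nontrivial (Fin k)]
    (hc : ∀ u v : List (Fin k), u.length = v.length → (wG A).Reachable u v)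
    (hdeg : ∀ w a b c, (wG A).Adj w a → (wG A).Adj w b → (wG A).Adj w c →
      a = b ∨ a = c ∨ b = c) :
    ∃ e : ℕ → List (Fin k), (∀ n, (e n).length = n) ∧ (∀ n, IsEnd A (e n)) ∧
      ∀ n, ∃ j, e (n + 1) = e n ++ [j] := by
  let P : List (Fin k) → Prop := fun w => {e | w <+: e ∧ IsEnd A e}.Infinite
  have P0 : P [] := by
    intro hf
    obtain ⟨N, hN⟩ := (hf.image List.length).bddAbove
    obtain ⟨w, hw, hw'⟩ := end_exists hA hc hdeg (N + 1)
    have := hN ⟨w, ⟨List.nil_prefix, hw'⟩, hw⟩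
    omega
  have PS : ∀ w, P w → ∃ j, P (w ++ [j]) := by
    intro w hw
    by_contra hcon
    push Not at hcon
    apply hw
    have : (⋃ j, {e | w ++ [j] <+: e ∧ IsEnd A e}).Finite :=
      Set.finite_iUnion fun j => Set.not_infinite.1 (hcon j)
    refine ((Set.finite_singleton w).union this).subset ?_
    rintro e ⟨⟨t, rfl⟩, he⟩
    cases t with
    | nil => left; simp
    | cons j t =>
      right
      exact mem_iUnion.2 ⟨j, ⟨t, by simp⟩, he⟩
  have PE : ∀ w, P w → IsEnd A w := by
    intro w hw
    obtain ⟨e, ⟨t, rfl⟩, he⟩ := hw.nonempty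
    exact end_prefix hA hc hdeg _ _ he
  choose c hcP using PS
  let E : ℕ → {w // P w} := fun n => Nat.rec ⟨[], P0⟩ (fun _ w => ⟨_, hcP w.1 w.2⟩) n
  have hE : ∀ n, (E (n + 1)).1 = (E n).1 ++ [c (E n).1 (E n).2] := fun n => rfl
  refine ⟨fun n => (E n).1, ?_, fun n => PE _ (E n).2, fun n => ⟨_, hE n⟩⟩
  intro n
  induction n with
  | zero => rfl
  | succ n ih => simp only [hE]; simp [ih]

theorem pos_exists (hA : GData A) [Nontrivial (Fin k)]
    (hc : ∀ u v : List (Fin k), u.length = v.length → (wG A).Reachable u v)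
    (hdeg : ∀ w a b c, (wG A).Adj w a → (wG A).Adj w b → (wG A).Adj w c →
      a = b ∨ a = c ∨ b = c) : ∃ pos, PosData A pos := by
  obtain ⟨e, hl, hend, hs⟩ := end_chain hA hc hdeg
  have hre : ∀ w : List (Fin k), (wG A).Reachable (e w.length) w := fun w => hc _ _ (hl _)
  have inj : ∀ u v : List (Fin k), u.length = v.length →
      (wG A).dist (e u.length) u = (wG A).dist (e v.length) v → u = v := by
    intro u v h hd
    have hr := hre v
    rw [← h] at hd hr
    exact dist_inj hdeg (hend _) _ u v (hre u) hr hd rfl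
  have hstep : ∀ u v : List (Fin k), (wG A).Adj u v → 
      (wG A).dist (e v.length) v ≤ (wG A).dist (e u.length) u + 1 := by
    intro u v h
    rw [← h.1]
    exact dist_adj (hre u) h
  have ivt : ∀ w i j m, (wG A).dist (e (w ++ [i]).length) (w ++ [i]) ≤ m →
      m ≤ (wG A).dist (e (w ++ [j]).length) (w ++ [j]) →
      ∃ l, (wG A).dist (e (w ++ [l]).length) (w ++ [l]) = m := by
    intro w i j m h1 h2
    simp only [List.length_append, List.length_singleton] at h1 h2 ⊢
    exact fib_ivt hA hc w (hl _) i j m h1 h2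
  have adj1 : ∀ u v : List (Fin k), u.length = v.length → 
      (wG A).dist (e u.length) u + 1 = (wG A).dist (e v.length) v → (wG A).Adj v u := by
    intro u v h hd
    obtain ⟨t, a, r, d⟩ := exists_prev (hre v) hd.symm
    have : t = u := by
      apply inj t u (a.1.symm.trans h.symm)
      rw [← a.1, d]
    rwa [← this]
  refine ⟨fun w => (wG A).dist (e w.length) w, inj, ?_, ?_, ivt⟩
  · intro u v h hne
    constructor
    · intro hn
      have a : (wG A).Adj u v := ⟨h, hne, hn⟩
      have h1 := hstep _ _ a
      have h2 := hstep _ _ a.symm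
      have h3 : (wG A).dist (e u.length) u ≠ (wG A).dist (e v.length) v :=
        fun h' => hne (inj u v h h')
      omega
    · rintro (hd | hd)
      · exact (adj1 u v h hd).symm.2.2
      · exact (adj1 v u h.symm hd).2.2
  · intro u v i j h huv
    have key : ∀ m v j, u.length = v.length → 
        (wG A).dist (e (v ++ [j]).length) (v ++ [j]) = m → 
        (wG A).dist (e u.length) u ≤ (wG A).dist (e v.length) v →
        ∃ i', (wG A).dist (e (u ++ [i']).length) (u ++ [i']) ≤ m := by
      intro m
      induction m with
      | zero =>
        intro v j h hd hle
        rw [(hre _).dist_eq_zero_iff] at hd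
        obtain ⟨j', hj⟩ := hs v.length
        simp only [List.length_append, List.length_singleton] at hd
        rw [hd] at hj
        have hv : v = e v.length := (List.append_inj_left hj (by simp [hl]))
        rw [← hv, SimpleGraph.dist_self] at hle
        have : u = v := inj u v h (by rw [← hv, SimpleGraph.dist_self]; omega)
        subst this
        refine ⟨j, ?_⟩
        simp only [List.length_append, List.length_singleton, hd, SimpleGraph.dist_self, le_refl]
      | succ m ih =>
        intro v j h hd hle
        by_cases huv : u = v
        · subst huv; exact ⟨j, hd.le⟩
        obtain ⟨t, a, r, d⟩ := exists_prev (hre _) hd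
        rw [a.1] at d
        have hlen := a.1
        rcases List.eq_nil_or_concat' t with rfl | ⟨v', j', rfl⟩
        · simp at hlen
        have hl' : v.length = v'.length := by simpa using hlen
        have : (wG A).dist (e v.length) v ≤ (wG A).dist (e v'.length) v' + 1 := by
          rcases adj_down hA a with rfl | a'
          · omega
          · exact hstep _ _ a'.symm
        have hne : (wG A).dist (e u.length) u ≠ (wG A).dist (e v.length) v :=
          fun h' => huv (inj u v h h')
        obtain ⟨i', hi'⟩ := ih v' j' (h.trans hl') d (by omega)
        exact ⟨i', by omega⟩
    obtain ⟨i', hi'⟩ := key _ v j h rfl huv.le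
    by_contra hlt
    obtain ⟨l, hl⟩ := ivt u i' i _ hi' (by omega)
    have h1 := inj _ _ (by simp [h]) hl
    have h2 : u = v := List.append_inj_left h1 h
    subst h2
    omega

end graph

section rays

def pre {k : ℕ} (x : ℕ → Fin k) (n : ℕ) : List (Fin k) := (List.range n).map x

lemma pre_succ {k : ℕ} (x : ℕ → Fin k) (n : ℕ) : pre x (n + 1) = pre x n ++ [x n] := by
  simp [pre, List.range_succ]

lemma pre_zero {k : ℕ} (x : ℕ → Fin k) : pre x 0 = [] := rfl

lemma pre_len {k : ℕ} (x : ℕ → Fin k) (n : ℕ) : (pre x n).length = n := by simp [pre]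

lemma pre_congr {k : ℕ} {x y : ℕ → Fin k} {n : ℕ} (h : ∀ m < n, x m = y m) : pre x n = pre y n := by
  simp only [pre]
  exact List.map_congr_left (fun m hm => h m (List.mem_range.1 hm))

lemma pre_inv {k : ℕ} {x y : ℕ → Fin k} {n : ℕ} (h : pre x n = pre y n) : ∀ m < n, x m = y m := by
  intro m hm
  simp only [pre] at h
  exact List.map_inj_left.1 h m (List.mem_range.2 hm)

lemma ray_exists {k : ℕ} (c : List (Fin k) → Fin k) :
    ∃ x : ℕ → Fin k, ∀ n, x n = c (pre x n) := by
  let W : ℕ → List (Fin k) := fun n => Nat.rec [] (fun _ v => v ++ [c v]) n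
  have hW : ∀ n, W (n + 1) = W n ++ [c (W n)] := fun n => rfl
  refine ⟨fun n => c (W n), ?_⟩
  have : ∀ n, pre (fun n => c (W n)) n = W n := by
    intro n
    induction n with
    | zero => rfl
    | succ n ih => rw [pre_succ, ih, hW]
  intro n
  rw [this]

lemma ray_from {k : ℕ} (c : List (Fin k) → Fin k) (x : ℕ → Fin k) (n0 : ℕ) :
    ∃ z : ℕ → Fin k, pre z n0 = pre x n0 ∧ ∀ n ≥ n0, z n = c (pre z n) := by
  obtain ⟨z, hz⟩ := ray_exists (fun v => if v.length < n0 then x v.length else c v)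
  refine ⟨z, pre_congr ?_, ?_⟩
  · intro m hm
    rw [hz]; simp [pre_len, hm]
  · intro n hn
    rw [hz]; simp [pre_len, hn]

lemma ray_pred {k : ℕ} (P : List (Fin k) → Prop) (h0 : P [])
    (hs : ∀ w, P w → ∃ j, P (w ++ [j])) : ∃ x : ℕ → Fin k, ∀ n, P (pre x n) := by
  obtain ⟨j0, -⟩ := hs [] h0
  have : ∀ w, ∃ j, P w → P (w ++ [j]) := by
    intro w
    by_cases h : P w
    · obtain ⟨j, hj⟩ := hs w h; exact ⟨j, fun _ => hj⟩
    · exact ⟨j0, fun h' => absurd h' h⟩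
  choose c hc using this
  obtain ⟨x, hx⟩ := ray_exists c
  refine ⟨x, fun n => ?_⟩
  induction n with
  | zero => exact h0
  | succ n ih => rw [pre_succ, hx]; exact hc _ ih

lemma first_diff {k : ℕ} {x y : ℕ → Fin k} (h : x ≠ y) :
    ∃ n, pre x n = pre y n ∧ x n ≠ y n := by
  classical
  have h' : ∃ n, x n ≠ y n := by
    by_contra hc; push Not at hc; exact h (funext hc)
  refine ⟨Nat.find h', pre_congr fun m hm => ?_, Nat.find_spec h'⟩
  have := Nat.find_min h' hm
  push Not at this
  exact this

/-- contraction weight of a word -/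
noncomputable def lw {k : ℕ} (L : Fin k → ℝ) (w : List (Fin k)) : ℝ := (w.map L).prod

lemma lw_snoc {k : ℕ} (L : Fin k → ℝ) (w : List (Fin k)) (j) : lw L (w ++ [j]) = lw L w * L j := by
  simp [lw]

lemma lw_pos {k : ℕ} {L : Fin k → ℝ} (hL : ∀ i, 0 < L i ∧ L i < 1) (w : List (Fin k)) :
    0 < lw L w := by
  induction w with
  | nil => simp [lw]
  | cons i w ih => simp only [lw, List.map_cons, List.prod_cons] at ih ⊢; exact mul_pos (hL i).1 ih

lemma lw_tendsto {k : ℕ} {L : Fin k → ℝ} (hL : ∀ i, 0 < L i ∧ L i < 1) (x : ℕ → Fin k) :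
    Filter.Tendsto (fun n => lw L (pre x n)) Filter.atTop (nhds 0) := by
  have : Nonempty (Fin k) := ⟨x 0⟩
  obtain ⟨i, hi⟩ := Finite.exists_max L
  refine squeeze_zero (fun n => (lw_pos hL _).le) (g := fun n => L i ^ n) ?_
    (tendsto_pow_atTop_nhds_zero_of_lt_one (hL i).1.le (hL i).2)
  intro n
  induction n with
  | zero => simp [pre, lw]
  | succ n ih =>
    rw [pre_succ, lw_snoc, pow_succ]
    exact mul_le_mul ih (hi _) (hL _).1.le (pow_nonneg (hL i).1.le _)

lemma lws_tendsto {k : ℕ} {L : Fin k → ℝ} (hL : ∀ i, 0 < L i ∧ L i < 1) {s : ℝ} (hs : 0 < s)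
    (x : ℕ → Fin k) :
    Filter.Tendsto (fun n => lw L (pre x n) ^ s) Filter.atTop (nhds 0) := by
  have := (lw_tendsto hL x).rpow_const (p := s) (Or.inr hs.le)
  rwa [Real.zero_rpow hs.ne'] at this

lemma lws_snoc {k : ℕ} {L : Fin k → ℝ} (hL : ∀ i, 0 < L i ∧ L i < 1) (s : ℝ) (w : List (Fin k)) (j) :
    lw L (w ++ [j]) ^ s = lw L w ^ s * L j ^ s := by
  rw [lw_snoc, Real.mul_rpow (lw_pos hL w).le (hL j).1.le]

/-- offset -/
noncomputable def off {k : ℕ} (L : Fin k → ℝ) (s : ℝ) (pos : List (Fin k) → ℕ) (w : List (Fin k))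
    (j : Fin k) : ℝ := ∑ i with pos (w ++ [i]) < pos (w ++ [j]), L i ^ s

lemma lo_exists {k : ℕ} (g : List (Fin k) → Fin k → ℝ) :
    ∃ lo : List (Fin k) → ℝ, lo [] = 0 ∧ ∀ w j, lo (w ++ [j]) = lo w + g w j := by
  let F : List (Fin k) × ℝ → Fin k → List (Fin k) × ℝ := fun p j => (p.1 ++ [j], p.2 + g p.1 j)
  have h1 : ∀ w, (List.foldl F ([], 0) w).1 = w := by
    intro w
    induction w using List.reverseRecOn with
    | nil => rfl
    | append_singleton w j ih => rw [List.foldl_append]; simp [F] at ih ⊢; exact ih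
  refine ⟨fun w => (List.foldl F ([], 0) w).2, rfl, fun w j => ?_⟩
  show (List.foldl F ([], 0) (w ++ [j])).2 = (List.foldl F ([], 0) w).2 + g w j
  rw [List.foldl_append]
  show (List.foldl F ([], 0) w).2 + g (List.foldl F ([], 0) w).1 j = _
  rw [h1]

section offl
variable {X : Type*} {k : ℕ} {A : List (Fin k) → Set X} {pos : List (Fin k) → ℕ}
  {L : Fin k → ℝ} {s : ℝ}

lemma sib_inj (hp : PosData A pos) {w : List (Fin k)} {i j : Fin k}
    (h : pos (w ++ [i]) = pos (w ++ [j])) : i = j := by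
  simpa using hp.inj _ _ (by simp) h

lemma off_insert (w : List (Fin k)) (i : Fin k) :
    off L s pos w i + L i ^ s =
      ∑ l ∈ insert i (Finset.univ.filter fun l => pos (w ++ [l]) < pos (w ++ [i])), L l ^ s := by
  rw [Finset.sum_insert (by simp), off, add_comm]

lemma off_lt (hL : ∀ i, 0 < L i ∧ L i < 1) {w : List (Fin k)} {i j : Fin k}
    (h : pos (w ++ [i]) < pos (w ++ [j])) : off L s pos w i + L i ^ s ≤ off L s pos w j := by
  rw [off_insert, off]
  apply Finset.sum_le_sum_of_subset_of_nonneg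
  · intro l hl
    simp only [Finset.mem_insert, Finset.mem_filter, Finset.mem_univ, true_and] at hl ⊢
    rcases hl with rfl | hl
    · exact h
    · omega
  · intro l _ _; exact Real.rpow_nonneg (hL l).1.le _

lemma off_gap (hL : ∀ i, 0 < L i ∧ L i < 1) {w : List (Fin k)} {i l j : Fin k}
    (h : pos (w ++ [i]) < pos (w ++ [l])) (h' : pos (w ++ [l]) < pos (w ++ [j])) :
    off L s pos w i + L i ^ s + L l ^ s ≤ off L s pos w j := by
  have := off_lt (s := s) hL h
  have := off_lt (s := s) hL h'
  linarith

lemma off_next (hp : PosData A pos) {w : List (Fin k)} {i j : Fin k}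
    (h : pos (w ++ [i]) + 1 = pos (w ++ [j])) : off L s pos w i + L i ^ s = off L s pos w j := by
  rw [off_insert, off]
  congr 1
  ext l
  simp only [Finset.mem_insert, Finset.mem_filter, Finset.mem_univ, true_and]
  constructor
  · rintro (rfl | hl) <;> omega
  · intro hl
    by_cases h' : pos (w ++ [l]) = pos (w ++ [i])
    · left; exact sib_inj hp h'
    · right; omega

lemma off_le (hL : ∀ i, 0 < L i ∧ L i < 1) (hdim : ∑ i, L i ^ s = 1) (w : List (Fin k))
    (i : Fin k) : off L s pos w i + L i ^ s ≤ 1 := by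
  rw [off_insert, ← hdim]
  apply Finset.sum_le_sum_of_subset_of_nonneg
  · exact Finset.subset_univ _
  · intro l _ _; exact Real.rpow_nonneg (hL l).1.le _

lemma off_last (hp : PosData A pos) (hdim : ∑ i, L i ^ s = 1) {w : List (Fin k)}
    {i : Fin k} (h : ∀ j, pos (w ++ [j]) ≤ pos (w ++ [i])) :
    off L s pos w i + L i ^ s = 1 := by
  rw [off_insert, ← hdim]
  congr 1
  ext l
  simp only [Finset.mem_insert, Finset.mem_filter, Finset.mem_univ, true_and, iff_true]
  rcases (h l).eq_or_lt with h' | h'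
  · left; exact sib_inj hp h'
  · right; exact h'

lemma off_nonneg (hL : ∀ i, 0 < L i ∧ L i < 1) (w : List (Fin k))
    (i : Fin k) : 0 ≤ off L s pos w i :=
  Finset.sum_nonneg fun l _ => Real.rpow_nonneg (hL l).1.le _

lemma off_first {w : List (Fin k)}
    {i : Fin k} (h : ∀ j, pos (w ++ [i]) ≤ pos (w ++ [j])) :
    off L s pos w i = 0 := by
  rw [off]
  apply Finset.sum_eq_zero
  intro l hl
  have := h l
  simp at hl
  omega

end offl
end rays

structure Ctx {X : Type*} [MetricSpace X] {k : ℕ} (A : List (Fin k) → Set X)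
    (pos : List (Fin k) → ℕ) (L : Fin k → ℝ) (s D : ℝ) (lo : List (Fin k) → ℝ)
    (t : (ℕ → Fin k) → ℝ) (pt : (ℕ → Fin k) → X) : Prop where
  hp : PosData A pos
  hA : GData A
  hL : ∀ i, 0 < L i ∧ L i < 1
  hs : 0 < s
  hdim : ∑ i, L i ^ s = 1
  hD : 0 ≤ D
  hdi : ∀ w, ∀ p ∈ A w, ∀ q ∈ A w, dist p q ≤ lw L w * D
  lo0 : lo [] = 0
  los : ∀ w j, lo (w ++ [j]) = lo w + lw L w ^ s * off L s pos w j
  t1 : ∀ x n, lo (pre x n) ≤ t x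
  t2 : ∀ x n, t x ≤ lo (pre x n) + lw L (pre x n) ^ s
  ptm : ∀ x n, pt x ∈ A (pre x n)

namespace Ctx
variable {X : Type*} [MetricSpace X] {k : ℕ} {A : List (Fin k) → Set X}
    {pos : List (Fin k) → ℕ} {L : Fin k → ℝ} {s D : ℝ} {lo : List (Fin k) → ℝ}
    {t : (ℕ → Fin k) → ℝ} {pt : (ℕ → Fin k) → X}

lemma sc (C : Ctx A pos L s D lo t pt) {m : ℕ} {r τ : ℝ} (w : List (Fin k)) (l : Fin k)
    (hr : 0 < r) (hrl : ∀ i, r ≤ L i) (h : lw L w ^ s * L l ^ s ≤ τ) :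
    lw L w * D ≤ D / r * τ ^ (1 / s) := by
  have hw := lw_pos C.hL w
  have h1 : (lw L w * r) ^ s ≤ τ := by
    rw [Real.mul_rpow hw.le hr.le]
    refine le_trans ?_ h
    exact mul_le_mul_of_nonneg_left (Real.rpow_le_rpow hr.le (hrl l) C.hs.le)
      (Real.rpow_nonneg hw.le _)
  have h2 : lw L w * r ≤ τ ^ (1 / s) := by
    have := Real.rpow_le_rpow (Real.rpow_nonneg (mul_pos hw hr).le _) h1 (one_div_pos.2 C.hs).le
    rwa [← Real.rpow_mul (mul_pos hw hr).le, mul_one_div_cancel C.hs.ne', Real.rpow_one] at this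
  calc lw L w * D = D / r * (lw L w * r) := by field_simp
    _ ≤ _ := mul_le_mul_of_nonneg_left h2 (div_nonneg C.hD hr.le)

lemma sib_lt (C : Ctx A pos L s D lo t pt) {w : List (Fin k)} {i j : Fin k}
    (h : pos (w ++ [i]) < pos (w ++ [j])) :
    lo (w ++ [i]) + lw L (w ++ [i]) ^ s ≤ lo (w ++ [j]) := by
  rw [C.los, C.los, lws_snoc C.hL]
  have := mul_le_mul_of_nonneg_left (off_lt (s := s) C.hL h)
    (Real.rpow_nonneg (lw_pos C.hL w).le s)
  linarith

lemma sib_next (C : Ctx A pos L s D lo t pt) {w : List (Fin k)} {i j : Fin k}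
    (h : pos (w ++ [i]) + 1 = pos (w ++ [j])) :
    lo (w ++ [i]) + lw L (w ++ [i]) ^ s = lo (w ++ [j]) := by
  rw [C.los, C.los, lws_snoc C.hL, ← off_next C.hp h]
  ring

lemma sib_last (C : Ctx A pos L s D lo t pt) {w : List (Fin k)} {i : Fin k}
    (h : ∀ j, pos (w ++ [j]) ≤ pos (w ++ [i])) :
    lo (w ++ [i]) + lw L (w ++ [i]) ^ s = lo w + lw L w ^ s := by
  have := off_last C.hp C.hdim h
  rw [C.los, lws_snoc C.hL, add_assoc, ← mul_add, this, mul_one]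

lemma sib_first (C : Ctx A pos L s D lo t pt) {w : List (Fin k)} {i : Fin k}
    (h : ∀ j, pos (w ++ [i]) ≤ pos (w ++ [j])) :
    lo (w ++ [i]) = lo w := by
  rw [C.los, off_first h, mul_zero, add_zero]

lemma t_last (C : Ctx A pos L s D lo t pt) {z : ℕ → Fin k} {n0 : ℕ}
    (hz : ∀ n ≥ n0, ∀ j, pos (pre z n ++ [j]) ≤ pos (pre z n ++ [z n])) :
    ∀ n ≥ n0, t z = lo (pre z n) + lw L (pre z n) ^ s := by
  have hconst : ∀ n ≥ n0, lo (pre z n) + lw L (pre z n) ^ s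
      = lo (pre z n0) + lw L (pre z n0) ^ s := by
    intro n hn
    induction n, hn using Nat.le_induction with
    | base => rfl
    | succ n hn ih => rw [pre_succ, C.sib_last (hz n hn), ih]
  have : t z = lo (pre z n0) + lw L (pre z n0) ^ s := by
    apply le_antisymm (C.t2 z n0)
    have h := (lws_tendsto C.hL C.hs z).const_add (t z)
    rw [add_zero] at h
    refine ge_of_tendsto h (Filter.eventually_atTop.2 ⟨n0, fun n hn => ?_⟩)
    rw [← hconst n hn]
    have := C.t1 z n
    linarith
  intro n hn
  rw [this, hconst n hn]

lemma t_first (C : Ctx A pos L s D lo t pt) {z : ℕ → Fin k} {n0 : ℕ}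
    (hz : ∀ n ≥ n0, ∀ j, pos (pre z n ++ [z n]) ≤ pos (pre z n ++ [j])) :
    ∀ n ≥ n0, t z = lo (pre z n) := by
  have hconst : ∀ n ≥ n0, lo (pre z n) = lo (pre z n0) := by
    intro n hn
    induction n, hn using Nat.le_induction with
    | base => rfl
    | succ n hn ih => rw [pre_succ, C.sib_first (hz n hn), ih]
  have : t z = lo (pre z n0) := by
    refine le_antisymm ?_ (C.t1 z n0)
    have h := (lws_tendsto C.hL C.hs z).const_add (lo (pre z n0))
    rw [add_zero] at h
    refine ge_of_tendsto h (Filter.eventually_atTop.2 ⟨n0, fun n hn => ?_⟩)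
    rw [← hconst n hn]
    exact C.t2 z n
  intro n hn
  rw [this, hconst n hn]

lemma dist_pre (C : Ctx A pos L s D lo t pt) {x y : ℕ → Fin k} {n : ℕ} (h : pre x n = pre y n) :
    dist (pt x) (pt y) ≤ lw L (pre x n) * D :=
  C.hdi _ _ (C.ptm x n) _ (h ▸ C.ptm y n)

lemma hold_last (C : Ctx A pos L s D lo t pt) {r : ℝ}
    (hr : 0 < r) (hrl : ∀ i, r ≤ L i) {x z : ℕ → Fin k} {n0 : ℕ} (he : pre x n0 = pre z n0)
    (hz : ∀ n ≥ n0, ∀ j, pos (pre z n ++ [j]) ≤ pos (pre z n ++ [z n])) :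
    t x ≤ t z ∧ dist (pt x) (pt z) ≤ D / r * (t z - t x) ^ (1 / s) := by
  by_cases hxz : x = z
  · subst hxz
    simp [Real.zero_rpow (inv_pos.2 C.hs).ne']
  obtain ⟨n, hn, hne⟩ := first_diff hxz
  have hn0 : n0 ≤ n := by
    by_contra hlt
    exact hne (pre_inv he n (by omega))
  have hlt : pos (pre z n ++ [x n]) < pos (pre z n ++ [z n]) :=
    lt_of_le_of_ne (hz n hn0 _) fun h => hne (sib_inj C.hp h)
  have h1 := C.sib_lt hlt
  have h2 := C.t2 x (n + 1)
  rw [pre_succ, hn] at h2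
  have h3 := C.t_last hz (n + 1) (by omega)
  rw [pre_succ, lws_snoc C.hL] at h3
  have h4 : lw L (pre z n) ^ s * L (z n) ^ s ≤ t z - t x := by linarith
  have h5 := C.dist_pre hn
  rw [hn] at h5
  refine ⟨?_, h5.trans (C.sc (m := 0) _ _ hr hrl h4)⟩
  have : 0 ≤ lw L (pre z n) ^ s * L (z n) ^ s :=
    mul_nonneg (Real.rpow_nonneg (lw_pos C.hL _).le _) (Real.rpow_nonneg (C.hL _).1.le _)
  linarith

lemma hold_first (C : Ctx A pos L s D lo t pt) {r : ℝ}
    (hr : 0 < r) (hrl : ∀ i, r ≤ L i) {x z : ℕ → Fin k} {n0 : ℕ} (he : pre x n0 = pre z n0)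
    (hz : ∀ n ≥ n0, ∀ j, pos (pre z n ++ [z n]) ≤ pos (pre z n ++ [j])) :
    t z ≤ t x ∧ dist (pt x) (pt z) ≤ D / r * (t x - t z) ^ (1 / s) := by
  by_cases hxz : x = z
  · subst hxz
    simp [Real.zero_rpow (inv_pos.2 C.hs).ne']
  obtain ⟨n, hn, hne⟩ := first_diff hxz
  have hn0 : n0 ≤ n := by
    by_contra hlt
    exact hne (pre_inv he n (by omega))
  have hlt : pos (pre z n ++ [z n]) < pos (pre z n ++ [x n]) :=
    lt_of_le_of_ne (hz n hn0 _) fun h => hne (sib_inj C.hp h.symm)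
  have h1 := C.sib_lt hlt
  have h2 := C.t1 x (n + 1)
  rw [pre_succ, hn] at h2
  have h3 := C.t_first hz (n + 1) (by omega)
  rw [pre_succ] at h3
  rw [lws_snoc C.hL] at h1
  have h4 : lw L (pre z n) ^ s * L (z n) ^ s ≤ t x - t z := by linarith
  have h5 := C.dist_pre hn
  rw [hn] at h5
  refine ⟨?_, h5.trans (C.sc (m := 0) _ _ hr hrl h4)⟩
  have : 0 ≤ lw L (pre z n) ^ s * L (z n) ^ s :=
    mul_nonneg (Real.rpow_nonneg (lw_pos C.hL _).le _) (Real.rpow_nonneg (C.hL _).1.le _)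
  linarith

lemma pt_eq_of_meet (C : Ctx A pos L s D lo t pt) {x y : ℕ → Fin k} {n0 : ℕ}
    (h : ∀ n ≥ n0, (A (pre x n) ∩ A (pre y n)).Nonempty) : pt x = pt y := by
  apply dist_le_zero.1
  have h1 := ((lw_tendsto C.hL x).mul_const D).add ((lw_tendsto C.hL y).mul_const D)
  simp only [zero_mul, add_zero] at h1
  refine ge_of_tendsto h1 (Filter.eventually_atTop.2 ⟨n0, fun n hn => ?_⟩)
  obtain ⟨p, hp1, hp2⟩ := h n hn
  exact (dist_triangle _ p _).trans
    (add_le_add (C.hdi _ _ (C.ptm x n) _ hp1) (C.hdi _ _ hp2 _ (C.ptm y n)))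

lemma glue (C : Ctx A pos L s D lo t pt) {z z' : ℕ → Fin k} {n0 : ℕ}
    (hz : ∀ n ≥ n0, ∀ j, pos (pre z n ++ [j]) ≤ pos (pre z n ++ [z n]))
    (hz' : ∀ n ≥ n0, ∀ j, pos (pre z' n ++ [z' n]) ≤ pos (pre z' n ++ [j]))
    (h0 : pos (pre z n0) + 1 = pos (pre z' n0)) : pt z = pt z' := by
  have meet : ∀ n, pos (pre z n) + 1 = pos (pre z' n) →
      (A (pre z n) ∩ A (pre z' n)).Nonempty := by
    intro n h
    refine (C.hp.adj _ _ (by simp [pre_len]) ?_).2 (Or.inl h)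
    intro h'; rw [h'] at h; omega
  have key : ∀ n ≥ n0, pos (pre z n) + 1 = pos (pre z' n) := by
    intro n hn
    induction n, hn using Nat.le_induction with
    | base => exact h0
    | succ n hn ih =>
      obtain ⟨p, h1, h2⟩ := meet n ih
      rw [C.hA.un] at h1 h2
      obtain ⟨i, hi⟩ := mem_iUnion.1 h1
      obtain ⟨j, hj⟩ := mem_iUnion.1 h2
      have hl : (pre z n).length = (pre z' n).length := by simp [pre_len]
      have c1 := C.hp.compat _ _ i j hl (by omega)
      have c2 := C.hp.compat _ _ (z n) (z' n) hl (by omega)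
      have hne : pre z n ++ [i] ≠ pre z' n ++ [j] := fun h => by rw [h] at c1; omega
      have := (C.hp.adj _ _ (by simp [pre_len]) hne).1 ⟨p, hi, hj⟩
      have a1 := hz n hn i
      have a2 := hz' n hn j
      rw [pre_succ, pre_succ]
      omega
  exact C.pt_eq_of_meet (n0 := n0) fun n hn => meet n (key n hn)

lemma holder_aux (C : Ctx A pos L s D lo t pt) {r : ℝ}
    (hr : 0 < r) (hrl : ∀ i, r ≤ L i) {x y : ℕ → Fin k} {n : ℕ} (hn : pre x n = pre y n)
    (hlt : pos (pre x n ++ [x n]) < pos (pre y n ++ [y n])) :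
    t x ≤ t y ∧ dist (pt x) (pt y) ≤ 3 * (D / r) * (t y - t x) ^ (1 / s) := by
  haveI : Nonempty (Fin k) := ⟨x 0⟩
  choose cl hcl using fun w : List (Fin k) => Finite.exists_max fun j => pos (w ++ [j])
  choose cf hcf using fun w : List (Fin k) => Finite.exists_min fun j => pos (w ++ [j])
  obtain ⟨z, z1, z2⟩ := ray_from cl x (n + 1)
  obtain ⟨z', z1', z2'⟩ := ray_from cf y (n + 1)
  have hz : ∀ m ≥ n + 1, ∀ j, pos (pre z m ++ [j]) ≤ pos (pre z m ++ [z m]) := by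
    intro m hm j; rw [z2 m hm]; exact hcl _ j
  have hz' : ∀ m ≥ n + 1, ∀ j, pos (pre z' m ++ [z' m]) ≤ pos (pre z' m ++ [j]) := by
    intro m hm j; rw [z2' m hm]; exact hcf _ j
  obtain ⟨a1, b1⟩ := C.hold_last hr hrl z1.symm hz
  obtain ⟨a2, b2⟩ := C.hold_first hr hrl z1'.symm hz'
  have hDr : 0 ≤ D / r := div_nonneg C.hD hr.le
  have tz := C.t_last hz (n + 1) le_rfl
  have tz' := C.t_first hz' (n + 1) le_rfl
  rw [z1, pre_succ] at tz
  rw [z1', pre_succ] at tz'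
  rw [hn] at hlt tz
  have mid : t z ≤ t z' := by
    rw [tz, tz']; exact C.sib_lt hlt
  have b3 : dist (pt z) (pt z') ≤ D / r * (t z' - t z) ^ (1 / s) := by
    rcases (Nat.succ_le_of_lt hlt).eq_or_lt with h | h
    · have : pt z = pt z' := by
        apply C.glue hz hz'
        rw [z1, z1', pre_succ, pre_succ, hn]; exact h
      rw [this, dist_self]
      exact mul_nonneg hDr (Real.rpow_nonneg (by linarith) _)
    · obtain ⟨l, hl⟩ := C.hp.ivt (pre y n) (x n) (y n) (pos (pre y n ++ [x n]) + 1) (by omega)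
        (by omega)
      have g1 := C.sib_lt (show pos (pre y n ++ [x n]) < pos (pre y n ++ [l]) by omega)
      have g2 := C.sib_lt (show pos (pre y n ++ [l]) < pos (pre y n ++ [y n]) by omega)
      rw [lws_snoc C.hL _ _ l] at g2
      have e1 : pre z n = pre y n := by
        rw [← hn]; exact pre_congr fun m hm => pre_inv z1 m (by omega)
      have e2 : pre z' n = pre y n := pre_congr fun m hm => pre_inv z1' m (by omega)
      have := C.dist_pre (e1.trans e2.symm)
      rw [e1] at this
      exact this.trans (C.sc (m := 0) _ l hr hrl (by rw [tz, tz']; linarith))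
  refine ⟨by linarith, ?_⟩
  have mono : ∀ a, 0 ≤ a → a ≤ t y - t x → D / r * a ^ (1 / s) ≤ D / r * (t y - t x) ^ (1 / s) :=
    fun a h0 h1 => mul_le_mul_of_nonneg_left
      (Real.rpow_le_rpow h0 h1 (one_div_pos.2 C.hs).le) hDr
  have m1 := mono (t z - t x) (by linarith) (by linarith)
  have m2 := mono (t z' - t z) (by linarith) (by linarith)
  have m3 := mono (t y - t z') (by linarith) (by linarith)
  have d1 := dist_triangle (pt x) (pt z) (pt y)
  have d2 := dist_triangle (pt z) (pt z') (pt y)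
  rw [dist_comm (pt z') (pt y)] at d2
  linarith

lemma holder (C : Ctx A pos L s D lo t pt) {r : ℝ}
    (hr : 0 < r) (hrl : ∀ i, r ≤ L i) (x y : ℕ → Fin k) :
    dist (pt x) (pt y) ≤ 3 * (D / r) * |t x - t y| ^ (1 / s) := by
  by_cases hxy : x = y
  · subst hxy
    simp [Real.zero_rpow (inv_pos.2 C.hs).ne']
  obtain ⟨n, hn, hne⟩ := first_diff hxy
  rcases lt_trichotomy (pos (pre x n ++ [x n])) (pos (pre y n ++ [y n])) with h | h | h
  · obtain ⟨h1, h2⟩ := C.holder_aux hr hrl hn h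
    rwa [abs_sub_comm, abs_of_nonneg (by linarith)]
  · rw [hn] at h; exact absurd (sib_inj C.hp h) hne
  · obtain ⟨h1, h2⟩ := C.holder_aux hr hrl hn.symm h
    rwa [abs_of_nonneg (by linarith), dist_comm]

lemma inj_aux (C : Ctx A pos L s D lo t pt) {x y : ℕ → Fin k} {n : ℕ} (hn : pre x n = pre y n)
    (hlt : pos (pre x n ++ [x n]) < pos (pre y n ++ [y n])) (he : pt x = pt y) : t x = t y := by
  have lt : ∀ m ≥ n + 1, pos (pre x m) < pos (pre y m) := by
    intro m hm
    induction m, hm using Nat.le_induction with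
    | base => rw [pre_succ, pre_succ]; exact hlt
    | succ m hm ih => rw [pre_succ, pre_succ]; exact C.hp.compat _ _ _ _ (by simp [pre_len]) ih
  have nx : ∀ m ≥ n + 1, pos (pre x m) + 1 = pos (pre y m) := by
    intro m hm
    have h := lt m hm
    have := (C.hp.adj (pre x m) (pre y m) (by simp [pre_len])
      (fun h' => by rw [h'] at h; omega)).1 ⟨pt x, C.ptm x m, he ▸ C.ptm y m⟩
    omega
  have hx : ∀ m ≥ n + 1, ∀ j, pos (pre x m ++ [j]) ≤ pos (pre x m ++ [x m]) := by
    intro m hm j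
    have h1 := nx (m + 1) (by omega)
    rw [pre_succ, pre_succ] at h1
    have := C.hp.compat _ _ j (y m) (by simp [pre_len]) (lt m hm)
    omega
  have hy : ∀ m ≥ n + 1, ∀ j, pos (pre y m ++ [y m]) ≤ pos (pre y m ++ [j]) := by
    intro m hm j
    have h1 := nx (m + 1) (by omega)
    rw [pre_succ, pre_succ] at h1
    have := C.hp.compat _ _ (x m) j (by simp [pre_len]) (lt m hm)
    omega
  rw [C.t_last hx (n + 1) le_rfl, C.t_first hy (n + 1) le_rfl]
  have := nx (n + 1) le_rfl
  rw [pre_succ, pre_succ, hn] at this ⊢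
  exact C.sib_next this

lemma inj (C : Ctx A pos L s D lo t pt) {x y : ℕ → Fin k} (he : pt x = pt y) : t x = t y := by
  by_cases hxy : x = y
  · rw [hxy]
  obtain ⟨n, hn, hne⟩ := first_diff hxy
  rcases lt_trichotomy (pos (pre x n ++ [x n])) (pos (pre y n ++ [y n])) with h | h | h
  · exact C.inj_aux hn h he
  · rw [hn] at h; exact absurd (sib_inj C.hp h) hne
  · exact (C.inj_aux hn.symm h he.symm).symm

lemma surj_pt (C : Ctx A pos L s D lo t pt) {p : X} (hp : p ∈ A []) : ∃ x, pt x = p := by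
  obtain ⟨x, hx⟩ := ray_pred (fun w => p ∈ A w) hp (by
    intro w hw
    rw [C.hA.un] at hw
    exact mem_iUnion.1 hw)
  refine ⟨x, dist_le_zero.1 ?_⟩
  have h1 := ((lw_tendsto C.hL x).mul_const D)
  simp only [zero_mul] at h1
  exact ge_of_tendsto' h1 fun n => C.hdi _ _ (C.ptm x n) _ (hx n)

lemma surj_t (C : Ctx A pos L s D lo t pt) {p : ℝ} (hp : p ∈ Icc (0:ℝ) 1) : ∃ x, t x = p := by
  have hk : Nonempty (Fin k) := by
    by_contra h
    rw [not_nonempty_iff] at h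
    have := C.hdim
    simp at this
  obtain ⟨x, hx⟩ := ray_pred (fun w => lo w ≤ p ∧ p ≤ lo w + lw L w ^ s)
    (by simpa [C.lo0, lw] using hp) (by
    rintro w ⟨h1, h2⟩
    obtain ⟨j0, hj0⟩ := Finite.exists_min fun j => pos (w ++ [j])
    have hne : (Finset.univ.filter fun j => lo (w ++ [j]) ≤ p).Nonempty :=
      ⟨j0, by simp [C.sib_first hj0, h1]⟩
    obtain ⟨j, hj, hmax⟩ := Finset.exists_max_image _ (fun j => pos (w ++ [j])) hne
    simp only [Finset.mem_filter, Finset.mem_univ, true_and] at hj hmax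
    refine ⟨j, hj, ?_⟩
    by_contra hcon
    push Not at hcon
    by_cases hl : ∀ l, pos (w ++ [l]) ≤ pos (w ++ [j])
    · rw [C.sib_last hl] at hcon; linarith
    · push Not at hl
      obtain ⟨l, hl⟩ := hl
      obtain ⟨l', hl'⟩ := C.hp.ivt w j l (pos (w ++ [j]) + 1) (by omega) (by omega)
      have := C.sib_next hl'.symm
      have := hmax l' (by linarith)
      omega)
  refine ⟨x, ?_⟩
  apply sub_eq_zero.1
  apply abs_eq_zero.1
  refine le_antisymm (ge_of_tendsto' (lws_tendsto C.hL C.hs x) fun n => ?_) (abs_nonneg _)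
  have a1 := C.t1 x n
  have a2 := C.t2 x n
  obtain ⟨a3, a4⟩ := hx n
  rw [abs_le]
  constructor <;> linarith

lemma t_mem (C : Ctx A pos L s D lo t pt) (x) : t x ∈ Icc (0:ℝ) 1 := by
  have a1 := C.t1 x 0
  have a2 := C.t2 x 0
  simp [pre_zero, C.lo0, lw] at a1 a2
  exact ⟨a1, a2⟩

theorem main (C : Ctx A pos L s D lo t pt) :
    ∃ (f : ℝ → X) (H : ℝ),
      Set.InjOn f (Icc 0 1) ∧ f '' Icc 0 1 = A [] ∧
      ∀ p ∈ Icc (0:ℝ) 1, ∀ q ∈ Icc (0:ℝ) 1,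
        dist (f p) (f q) ≤ H * |p - q| ^ (1 / s) := by
  have hk : Nonempty (Fin k) := by
    by_contra h
    rw [not_nonempty_iff] at h
    have := C.hdim
    simp at this
  obtain ⟨i, hi⟩ := Finite.exists_min L
  have ch : ∀ p : ℝ, ∃ x, p ∈ Icc (0:ℝ) 1 → t x = p := by
    intro p
    by_cases h : p ∈ Icc (0:ℝ) 1
    · obtain ⟨x, hx⟩ := C.surj_t h; exact ⟨x, fun _ => hx⟩
    · exact ⟨fun _ => i, fun h' => absurd h' h⟩
  choose g hg using ch
  refine ⟨fun p => pt (g p), 3 * (D / L i), ?_, ?_, ?_⟩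
  · intro p hp q hq h
    rw [← hg p hp, ← hg q hq]
    exact C.inj h
  · apply Subset.antisymm
    · rintro _ ⟨p, hp, rfl⟩
      exact C.ptm (g p) 0
    · intro p hp
      obtain ⟨x, rfl⟩ := C.surj_pt hp
      refine ⟨t x, C.t_mem x, dist_le_zero.1 ?_⟩
      have := C.holder (C.hL i).1 hi (g (t x)) x
      rw [hg _ (C.t_mem x), sub_self, abs_zero,
        Real.zero_rpow (one_div_pos.2 C.hs).ne', mul_zero] at this
      exact this
  · intro p hp q hq
    have := C.holder (C.hL i).1 hi (g p) (g q)
    rwa [hg p hp, hg q hq] at this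

end Ctx

section final
variable {X : Type*} {k : ℕ}

lemma cw_app (φ : Fin k → X → X) (w u : List (Fin k)) :
    compWord φ (w ++ u) = compWord φ w ∘ compWord φ u := by
  induction w with
  | nil => rfl
  | cons i w ih =>
    show φ i ∘ compWord φ (w ++ u) = (φ i ∘ compWord φ w) ∘ compWord φ u
    rw [ih]; rfl

lemma cw_un (φ : Fin k → X → X) {K : Set X} (hK : K = ⋃ i, φ i '' K) (w : List (Fin k)) :
    compWord φ w '' K = ⋃ j, compWord φ (w ++ [j]) '' K := by
  conv_lhs => rw [hK]
  rw [image_iUnion]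
  congr 1
  ext1 j
  rw [cw_app, image_comp]
  rfl

lemma cw_dist [MetricSpace X] (φ : Fin k → X → X) {L : Fin k → ℝ}
    (hL : ∀ i, 0 < L i ∧ L i < 1)
    (hLip : ∀ i x y, dist (φ i x) (φ i y) ≤ L i * dist x y) (w : List (Fin k)) (x y : X) :
    dist (compWord φ w x) (compWord φ w y) ≤ lw L w * dist x y := by
  induction w with
  | nil => simp [compWord, lw]
  | cons i w ih =>
    show dist (φ i (compWord φ w x)) (φ i (compWord φ w y)) ≤ _
    refine (hLip _ _ _).trans ?_
    simp only [lw, List.map_cons, List.prod_cons] at ih ⊢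
    rw [mul_assoc]
    exact mul_le_mul_of_nonneg_left ih (hL i).1.le

lemma cw_cover (φ : Fin k → X → X) {K : Set X} (hK : K = ⋃ i, φ i '' K) (n : ℕ) :
    ∀ p ∈ K, ∃ w : List (Fin k), w.length = n ∧ p ∈ compWord φ w '' K := by
  intro p hp
  induction n with
  | zero => exact ⟨[], rfl, p, hp, rfl⟩
  | succ n ih =>
    obtain ⟨w, hw, hpw⟩ := ih
    rw [cw_un φ hK] at hpw
    obtain ⟨j, hj⟩ := mem_iUnion.1 hpw
    exact ⟨w ++ [j], by simp [hw], hj⟩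

lemma cw_sub (φ : Fin k → X → X) {K : Set X} (hK : K = ⋃ i, φ i '' K) (w : List (Fin k)) :
    compWord φ w '' K ⊆ K := by
  induction w using List.reverseRecOn with
  | nil => simp [compWord]
  | append_singleton w j ih =>
    refine Subset.trans ?_ ih
    rw [cw_un φ hK w]
    exact subset_iUnion (fun j => compWord φ (w ++ [j]) '' K) j

lemma cw_conn [MetricSpace X] (φ : Fin k → X → X) {K : Set X} (hK : K = ⋃ i, φ i '' K)
    (hcl : ∀ w, IsClosed (compWord φ w '' K)) (hne : K.Nonempty) (hconn : IsConnected K)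
    (u v : List (Fin k)) (huv : u.length = v.length) :
    (wG fun w => compWord φ w '' K).Reachable u v := by
  set G := wG fun w => compWord φ w '' K with hG
  by_contra hcon
  let S := {w : List (Fin k) | w.length = u.length ∧ G.Reachable u w}
  let T := {w : List (Fin k) | w.length = u.length ∧ ¬ G.Reachable u w}
  have hfin := List.finite_length_eq (Fin k) u.length
  have hS : S.Finite := hfin.subset fun w h => h.1
  have hT : T.Finite := hfin.subset fun w h => h.1
  have := isPreconnected_closed_iff.1 hconn.2 (⋃ w ∈ S, compWord φ w '' K)
    (⋃ w ∈ T, compWord φ w '' K) (hS.isClosed_biUnion fun w _ => hcl w)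
    (hT.isClosed_biUnion fun w _ => hcl w) (by
      intro p hp
      obtain ⟨w, hw, hpw⟩ := cw_cover φ hK u.length p hp
      by_cases h : G.Reachable u w
      · exact Or.inl (mem_biUnion (show w ∈ S from ⟨hw, h⟩) hpw)
      · exact Or.inr (mem_biUnion (show w ∈ T from ⟨hw, h⟩) hpw))
    (by
      obtain ⟨p, hp⟩ := hne.image (compWord φ u)
      exact ⟨p, cw_sub φ hK _ hp, mem_biUnion (show u ∈ S from ⟨rfl, SimpleGraph.Reachable.refl _⟩) hp⟩)
    (by
      obtain ⟨p, hp⟩ := hne.image (compWord φ v)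
      exact ⟨p, cw_sub φ hK _ hp, mem_biUnion (show v ∈ T from ⟨huv.symm, hcon⟩) hp⟩)
  obtain ⟨p, -, h1, h2⟩ := this
  obtain ⟨a, ha, hpa⟩ := mem_iUnion₂.1 h1
  obtain ⟨b, hb, hpb⟩ := mem_iUnion₂.1 h2
  have hab : a ≠ b := by rintro rfl; exact hb.2 ha.2
  have : G.Adj a b := ⟨ha.1.trans hb.1.symm, hab, p, hpa, hpb⟩
  exact hb.2 (ha.2.trans this.reachable)

end final

/-- An IFS with connected attractor of positive diameter and no branching admits a
`(1/s)`-Hölder homeomorphic parameterization by `[0,1]`, where `s` is the similarity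
dimension. -/
theorem stmt13 {X : Type*} [MetricSpace X] [CompleteSpace X] {k : ℕ}
    (φ : Fin k → X → X) (L : Fin k → ℝ)
    (hL : ∀ i, 0 < L i ∧ L i < 1)
    (hLip : ∀ i x y, dist (φ i x) (φ i y) ≤ L i * dist x y)
    (s : ℝ) (hs : 0 < s) (hdim : ∑ i, L i ^ s = 1)
    (K : Set X) (hKne : K.Nonempty) (hKc : IsCompact K)
    (hK : K = ⋃ i, φ i '' K) (hconn : IsConnected K)
    (hdiam : 0 < Metric.diam K)
    (hnb : ∀ (n : ℕ) (w : List (Fin k)), w.length = n →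
      {u : List (Fin k) | u.length = n ∧ u ≠ w ∧
        (compWord φ u '' K ∩ compWord φ w '' K).Nonempty}.ncard ≤ 2) :
    ∃ (f : ℝ → X) (H : ℝ),
      Set.InjOn f (Icc 0 1) ∧ f '' Icc 0 1 = K ∧
      ∀ p ∈ Icc (0:ℝ) 1, ∀ q ∈ Icc (0:ℝ) 1,
        dist (f p) (f q) ≤ H * |p - q| ^ (1 / s) := by
  have hnt : Nontrivial (Fin k) := by
    by_contra h
    rw [not_nontrivial_iff_subsingleton] at h
    rcases isEmpty_or_nonempty (Fin k) with h' | ⟨⟨i⟩⟩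
    · simp at hdim
    · have : ∑ j, L j ^ s = L i ^ s := Fintype.sum_subsingleton _ i
      rw [this] at hdim
      have := Real.rpow_lt_one (hL i).1.le (hL i).2 hs
      linarith
  set A : List (Fin k) → Set X := fun w => compWord φ w '' K with hAdef
  have hcomp : ∀ w, IsCompact (A w) := by
    intro w
    have : LipschitzWith (Real.toNNReal (lw L w)) (compWord φ w) :=
      LipschitzWith.of_dist_le_mul fun x y => by
        rw [Real.coe_toNNReal _ (lw_pos hL w).le]; exact cw_dist φ hL hLip w x y
    exact hKc.image this.continuous
  have hA : GData A := by
    refine ⟨fun w => hKne.image _, cw_un φ hK, ?_⟩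
    rintro w u v ⟨p, ⟨a, ha, rfl⟩, b, hb, hab⟩
    refine ⟨compWord φ w (compWord φ u a), ⟨a, ha, by rw [cw_app]; rfl⟩, b, hb, ?_⟩
    rw [cw_app, ← hab]; rfl
  have hc := cw_conn φ hK (fun w => (hcomp w).isClosed) hKne hconn
  have hdeg : ∀ w a b c, (wG A).Adj w a → (wG A).Adj w b → (wG A).Adj w c →
      a = b ∨ a = c ∨ b = c := by
    intro w a b c ha hb hcc
    by_contra hcon
    push Not at hcon
    have h1 := hnb w.length w rfl
    have hfin : {u : List (Fin k) | u.length = w.length ∧ u ≠ w ∧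
        (compWord φ u '' K ∩ compWord φ w '' K).Nonempty}.Finite :=
      (List.finite_length_eq (Fin k) w.length).subset fun u h => h.1
    have hsub : ({a, b, c} : Set (List (Fin k))) ⊆ {u : List (Fin k) | u.length = w.length ∧ u ≠ w ∧
        (compWord φ u '' K ∩ compWord φ w '' K).Nonempty} := by
      rintro u (rfl | rfl | rfl)
      · exact ha.symm
      · exact hb.symm
      · exact hcc.symm
    have h2 := Set.ncard_le_ncard hsub hfin
    rw [Set.ncard_eq_three.2 ⟨a, b, c, hcon.1, hcon.2.1, hcon.2.2, rfl⟩] at h2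
    omega
  obtain ⟨pos, hp⟩ := pos_exists hA hc hdeg
  obtain ⟨lo, lo0, los⟩ := lo_exists (fun w j => lw L w ^ s * off L s pos w j)
  have hmono : ∀ x : ℕ → Fin k, Monotone fun n => lo (pre x n) := by
    intro x
    refine monotone_nat_of_le_succ fun n => ?_
    rw [pre_succ, los]
    have := mul_nonneg (Real.rpow_nonneg (lw_pos hL (pre x n)).le s)
      (off_nonneg (s := s) (pos := pos) hL (pre x n) (x n))
    linarith
  have hanti : ∀ x : ℕ → Fin k, Antitone fun n => lo (pre x n) + lw L (pre x n) ^ s := by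
    intro x
    refine antitone_nat_of_succ_le fun n => ?_
    rw [pre_succ, los, lws_snoc hL, add_assoc, ← mul_add]
    have := mul_le_mul_of_nonneg_left (off_le (pos := pos) hL hdim (pre x n) (x n))
      (Real.rpow_nonneg (lw_pos hL (pre x n)).le s)
    linarith
  have ht : ∀ x : ℕ → Fin k, ∃ t : ℝ, ∀ n, lo (pre x n) ≤ t ∧
      t ≤ lo (pre x n) + lw L (pre x n) ^ s := by
    intro x
    have := (hmono x).ciSup_mem_iInter_Icc_of_antitone (hanti x) (fun n => by
      have := Real.rpow_nonneg (lw_pos hL (pre x n)).le s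
      simp only; linarith)
    exact ⟨_, fun n => mem_iInter.1 this n⟩
  choose t ht using ht
  have hpt : ∀ x : ℕ → Fin k, ∃ p, ∀ n, p ∈ A (pre x n) := by
    intro x
    obtain ⟨p, hp⟩ := IsCompact.nonempty_iInter_of_sequence_nonempty_isCompact_isClosed
      (fun n => A (pre x n)) (by
        intro n
        show A (pre x (n + 1)) ⊆ A (pre x n)
        rw [pre_succ, hA.un (pre x n)]
        exact subset_iUnion (fun j => A (pre x n ++ [j])) _)
      (fun n => hA.ne _) (hcomp _) (fun n => (hcomp _).isClosed)
    exact ⟨p, mem_iInter.1 hp⟩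
  choose pt hpt using hpt
  have C : Ctx A pos L s (Metric.diam K) lo t pt :=
    { hp := hp, hA := hA, hL := hL, hs := hs, hdim := hdim, hD := hdiam.le
      hdi := by
        rintro w _ ⟨a, ha, rfl⟩ _ ⟨b, hb, rfl⟩
        exact (cw_dist φ hL hLip w a b).trans (mul_le_mul_of_nonneg_left
          (Metric.dist_le_diam_of_mem hKc.isBounded ha hb) (lw_pos hL w).le)
      lo0 := lo0, los := los
      t1 := fun x n => (ht x n).1, t2 := fun x n => (ht x n).2, ptm := hpt }
  have h0 : A [] = K := by simp [hAdef, compWord]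
  have := C.main
  rwa [h0] at this
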